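/- arXiv:1311.4477 — 3 statements merged into one kernel-verified Lean document; each statement's English description precedes it below -/
import Mathlib

section
/- Let f ∈ 𝒢_λ. Then there exists a formal power series H_f(x) = Σ_{k≥1} b_k x^k over ℂ_p with b₁ = 1 and H_f ∘ f = λ·H_f (as formal power series), and its coefficients satisfy |b_k| ≤ ( Π_{n=1}^{k-1} |1 - λ^n| )^{-1} for all k ≥ 2. -/
open scoped BigOperators

noncomputable section

/-- `R(s) = p^{-1/(p^{s-1}(p-1))}` for `s ≥ 1`, and `R(0) = 0`. -/
def Rr (p : ℕ) (s : ℕ) : ℝ :=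
  if s = 0 then 0 else (p : ℝ) ^ (-(1 : ℝ) / ((p : ℝ) ^ (s - 1) * ((p : ℝ) - 1)))

/-- The group `Γ_r` of `p`-power roots of unity. -/
def GammaR (p : ℕ) (K : Type*) [Monoid K] : Set K := {z | ∃ k : ℕ, z ^ p ^ k = 1}

/-- The quantity `r̃(λ)`. -/
def rTilde {K : Type*} [NontriviallyNormedField K] (p : ℕ) (lam γ₀ : K) (m s t : ℕ) : ℝ :=
  Rr p (s + 1) ^ ((1 : ℝ) / m) *
    (p : ℝ) ^ (-(((s : ℝ) - (t : ℝ)) / ((m : ℝ) * (p : ℝ) ^ s))) *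
    ‖1 - lam ^ m‖ ^ ((s : ℝ) * ((p : ℝ) - 1) / ((m : ℝ) * (p : ℝ))) *
    ‖γ₀ - lam ^ m‖ ^ ((1 : ℝ) / ((m : ℝ) * (p : ℝ) ^ ((s : ℝ) - (t : ℝ))))

/-- Coefficient of `x^k` in the formal composition `H ∘ F`, where `H, F` are given by their
coefficient sequences `b, c` and `F` has zero constant term. -/
def compCoeff {K : Type*} [Field K] (b c : ℕ → K) (k : ℕ) : K :=
  ∑ l ∈ Finset.range (k + 1), b l * PowerSeries.coeff k ((PowerSeries.mk c) ^ l)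

/-- `b` is (the coefficient sequence of) the normalized formal linearizing conjugacy `H_f` for the
power series `f` with coefficient sequence `c`: `H(0)=0`, `H'(0)=1` and `H ∘ f = λ·H` as formal
power series. -/
def IsConjugacy {K : Type*} [Field K] (lam : K) (c b : ℕ → K) : Prop :=
  b 0 = 0 ∧ b 1 = 1 ∧ ∀ k, compCoeff b c k = lam * b k

/-- Evaluation of the power series with coefficients `b` at `x`. -/
def pEval {K : Type*} [NontriviallyNormedField K] (b : ℕ → K) (x : K) : K :=
  ∑' k, b k * x ^ k

/-- `f` is analytically linearizable on `U` (a disk about `0`): `f` maps `U` to itself and some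
convergent power series `h` with `h(0)=0`, `h'(0)=1` maps `U` bijectively onto itself and
conjugates `f` to `x ↦ λx` on `U`. -/
def LinearizableOn {K : Type*} [NontriviallyNormedField K] (f : K → K) (lam : K)
    (U : Set K) : Prop :=
  Set.MapsTo f U U ∧
    ∃ b : ℕ → K, b 0 = 0 ∧ b 1 = 1 ∧
      (∀ x ∈ U, Summable fun k => b k * x ^ k) ∧
      Set.BijOn (pEval b) U U ∧
      ∀ x ∈ U, pEval b (f x) = lam * pEval b x

/-- A disk about `0`: an open or closed ball centered at the origin. -/
def IsZeroDisk {K : Type*} [NontriviallyNormedField K] (U : Set K) : Prop :=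
  ∃ ρ : ℝ, U = Metric.ball (0 : K) ρ ∨ U = Metric.closedBall (0 : K) ρ

/-- `x` is a periodic point of `f` of minimal period `q`. -/
def IsMinPeriodicPt {K : Type*} (f : K → K) (q : ℕ) (x : K) : Prop :=
  f^[q] x = x ∧ ∀ j, 1 ≤ j → j < q → f^[j] x ≠ x

/-- The valuation `ν(x) = -log_p |x|`. -/
def nuP {K : Type*} [NontriviallyNormedField K] (p : ℕ) (z : K) : ℝ :=
  -Real.logb p ‖z‖

/-- `κ_n = -(ν(1-λ^{p^n}) - ν(1-λ^{p^{n-1}}))/p^n`. -/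
def kappaN {K : Type*} [NontriviallyNormedField K] (p : ℕ) (lam : K) (n : ℕ) : ℝ :=
  -(nuP p (1 - lam ^ p ^ n) - nuP p (1 - lam ^ p ^ (n - 1))) / (p : ℝ) ^ n

open Classical in
/-- The multiplicity of `x` as a zero of the analytic function `g`. -/
def analyticMult {K : Type*} [NontriviallyNormedField K] (g : K → K) (x : K) : ℕ :=
  if h : AnalyticAt K g x then (analyticOrderAt g x).toNat else 0

/-- The radius `r(P_λ) = |1-λ|^{-1/p}·r̃(λ)` of quadratic linearization disks. -/
def rQuad {K : Type*} [NontriviallyNormedField K] (p : ℕ) (lam γ₀ : K) (m s t : ℕ) : ℝ :=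
  ‖1 - lam‖ ^ (-(1 : ℝ) / (p : ℝ)) * rTilde p lam γ₀ m s t

/-- The quantity `Ψ(λ) = |1-λ|^{-1/p}·p^{-(s-t)/p^s}·|γ₀-λ|^{1/p^{s-t}}` (case `m = 1`). -/
def PsiL {K : Type*} [NontriviallyNormedField K] (p : ℕ) (lam γ₀ : K) (s t : ℕ) : ℝ :=
  ‖1 - lam‖ ^ (-(1 : ℝ) / (p : ℝ)) *
    (p : ℝ) ^ (-(((s : ℝ) - (t : ℝ)) / (p : ℝ) ^ s)) *
    ‖γ₀ - lam‖ ^ ((1 : ℝ) / (p : ℝ) ^ ((s : ℝ) - (t : ℝ)))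

/-- Coefficient sequence of the quadratic polynomial `P_λ(x) = λx + x²`. -/
def quadCoeff {K : Type*} [Field K] (lam : K) : ℕ → K :=
  fun i => if i = 1 then lam else if i = 2 then 1 else 0

/-- `δ(z) = (k-1)/z - ⌊(k-1)/z⌋` as a rational number. -/
def deltaFrac (k z : ℕ) : ℚ :=
  ((k : ℚ) - 1) / (z : ℚ) - (((k - 1) / z : ℕ) : ℚ)

end

section

open Finset PowerSeries

/-- The normalized solution of the recursion for the coefficients of a linearizing conjugacy. -/
noncomputable def conjugacyCoeff {K : Type*} [Field K] (lam : K) (c : ℕ → K) : ℕ → K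
  | 0 => 0
  | 1 => 1
  | k + 2 => (lam - lam ^ (k + 2))⁻¹ *
      ∑ l : Fin (k + 2), conjugacyCoeff lam c l * coeff (k + 2) (mk c ^ (l : ℕ))

theorem conjugacyCoeff_add_two {K : Type*} [Field K] (lam : K) (c : ℕ → K) (k : ℕ) :
    conjugacyCoeff lam c (k + 2) = (lam - lam ^ (k + 2))⁻¹ *
      ∑ l ∈ range (k + 2), conjugacyCoeff lam c l * coeff (k + 2) (mk c ^ l) := by
  rw [conjugacyCoeff, Finset.sum_range fun l => conjugacyCoeff lam c l * coeff (k + 2) (mk c ^ l)]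

theorem PowerSeries.coeff_self_pow_of_constantCoeff_eq_zero {R : Type*} [CommRing R]
    {F : PowerSeries R} (hF : constantCoeff F = 0) (k : ℕ) :
    coeff k (F ^ k) = coeff 1 F ^ k := by
  obtain ⟨G, rfl⟩ := X_dvd_iff.mpr hF
  have h : coeff k (X ^ k * G ^ k) = coeff 0 (G ^ k) := by
    simpa using coeff_X_pow_mul (G ^ k) k 0
  rw [mul_pow, h, show (1 : ℕ) = 0 + 1 from rfl, coeff_succ_X_mul]
  simp

theorem PowerSeries.norm_coeff_pow_le_one {K : Type*} [NormedField K] [IsUltrametricDist K]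
    {F : PowerSeries K} (hF : ∀ i, ‖coeff i F‖ ≤ 1) (l k : ℕ) : ‖coeff k (F ^ l)‖ ≤ 1 := by
  induction l generalizing k with
  | zero =>
    rw [pow_zero, coeff_one]
    split_ifs <;> simp
  | succ l ih =>
    rw [pow_succ, coeff_mul]
    refine IsUltrametricDist.norm_sum_le_of_forall_le_of_nonneg zero_le_one fun x _ => ?_
    rw [norm_mul]
    exact mul_le_one₀ (ih _) (norm_nonneg _) (hF _)

theorem isConjugacy_conjugacyCoeff {K : Type*} [Field K] {lam : K} (hlam : lam ≠ 0)
    (hroot : ∀ n : ℕ, 1 ≤ n → lam ^ n ≠ 1) {c : ℕ → K} (hc0 : c 0 = 0) (hc1 : c 1 = lam) :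
    IsConjugacy lam c (conjugacyCoeff lam c) := by
  refine ⟨by simp [conjugacyCoeff], by simp [conjugacyCoeff], fun k => ?_⟩
  have hdiag : coeff k (mk c ^ k) = lam ^ k := by
    rw [coeff_self_pow_of_constantCoeff_eq_zero (by simp [← coeff_zero_eq_constantCoeff_apply, hc0]),
      coeff_mk, hc1]
  rw [compCoeff, sum_range_succ, hdiag]
  match k with
  | 0 => simp [conjugacyCoeff]
  | 1 => simp [conjugacyCoeff]
  | k + 2 =>
    have hne : lam - lam ^ (k + 2) ≠ 0 := by
      rw [show lam - lam ^ (k + 2) = lam * (1 - lam ^ (k + 1)) by ring]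
      exact mul_ne_zero hlam (sub_ne_zero.mpr (hroot (k + 1) (by lia)).symm)
    have hsum := conjugacyCoeff_add_two lam c k
    rw [eq_inv_mul_iff_mul_eq₀ hne] at hsum
    rw [← hsum]
    ring

theorem monotone_inv_prod_norm_one_sub_pow {K : Type*} [NormedField K] [IsUltrametricDist K]
    {lam : K} (hlam : ‖lam‖ = 1) (hroot : ∀ n : ℕ, 1 ≤ n → lam ^ n ≠ 1) :
    Monotone fun k : ℕ => (∏ n ∈ Icc 1 k, ‖1 - lam ^ n‖)⁻¹ := by
  refine monotone_nat_of_le_succ fun k => ?_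
  have hpos : ∀ m : ℕ, 0 < ∏ n ∈ Icc 1 m, ‖1 - lam ^ n‖ := fun m => prod_pos fun n hn =>
    norm_pos_iff.mpr (sub_ne_zero.mpr (hroot n (mem_Icc.mp hn).1).symm)
  refine inv_anti₀ (hpos _) ?_
  rw [prod_Icc_succ_top (by lia)]
  refine mul_le_of_le_one_right (hpos k).le ?_
  simpa [sub_eq_add_neg, hlam] using IsUltrametricDist.norm_add_le_max (1 : K) (-lam ^ (k + 1))

theorem norm_conjugacyCoeff_le {K : Type*} [NormedField K] [IsUltrametricDist K]
    {lam : K} (hlam : ‖lam‖ = 1) (hroot : ∀ n : ℕ, 1 ≤ n → lam ^ n ≠ 1)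
    {c : ℕ → K} (hc : ∀ i, ‖c i‖ ≤ 1) (k : ℕ) :
    ‖conjugacyCoeff lam c k‖ ≤ (∏ n ∈ Icc 1 (k - 1), ‖1 - lam ^ n‖)⁻¹ := by
  induction k using Nat.strong_induction_on with
  | _ k ih =>
  match k with
  | 0 => simp [conjugacyCoeff]
  | 1 => simp [conjugacyCoeff]
  | k + 2 =>
    have hden : ‖lam - lam ^ (k + 2)‖ = ‖1 - lam ^ (k + 1)‖ := by
      rw [show lam - lam ^ (k + 2) = lam * (1 - lam ^ (k + 1)) by ring, norm_mul, hlam, one_mul]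
    rw [conjugacyCoeff_add_two, norm_mul, norm_inv, hden, show k + 2 - 1 = k + 1 from rfl,
      prod_Icc_succ_top (by lia), mul_inv_rev]
    refine mul_le_mul_of_nonneg_left ?_ (by positivity)
    refine IsUltrametricDist.norm_sum_le_of_forall_le_of_nonneg (by positivity) fun l hl => ?_
    rw [norm_mul]
    have hl' := mem_range.mp hl
    calc _ ≤ ‖conjugacyCoeff lam c l‖ := mul_le_of_le_one_right (norm_nonneg _)
          (norm_coeff_pow_le_one (by simpa using hc) l _)
      _ ≤ _ := ih l hl'
      _ ≤ _ := monotone_inv_prod_norm_one_sub_pow hlam hroot (by lia)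

end

/-- Lemma: existence and coefficient bounds for the formal conjugacy.
For `f ∈ 𝒢_λ` there is a formal power series `H_f = Σ b_k x^k` with `b₁ = 1` and
`H_f ∘ f = λ·H_f`, whose coefficients satisfy
`|b_k| ≤ (Π_{n=1}^{k-1} |1-λ^n|)⁻¹` for all `k ≥ 2`. -/
theorem stmt4 (p : ℕ) [Fact p.Prime]
    {K : Type*} [NontriviallyNormedField K] [IsUltrametricDist K] [CompleteSpace K]
    [IsAlgClosed K] [Algebra ℚ_[p] K]
    (hiso : ∀ x : ℚ_[p], ‖algebraMap ℚ_[p] K x‖ = ‖x‖)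
    (hdense : Dense {x : K | IsAlgebraic ℚ_[p] x})
    (lam : K) (hlam : ‖lam‖ = 1) (hroot : ∀ n : ℕ, 1 ≤ n → lam ^ n ≠ 1)
    (c : ℕ → K) (hc0 : c 0 = 0) (hc1 : c 1 = lam) (hc : ∀ i, ‖c i‖ ≤ 1) :
    ∃ b : ℕ → K, IsConjugacy lam c b ∧
      ∀ k : ℕ, 2 ≤ k → ‖b k‖ ≤ (∏ n ∈ Finset.Icc 1 (k - 1), ‖1 - lam ^ n‖)⁻¹ := by
  have hne : lam ≠ 0 := norm_ne_zero_iff.mp (by simp [hlam])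
  exact ⟨conjugacyCoeff lam c, isConjugacy_conjugacyCoeff hne hroot hc0 hc1,
    fun k _ => norm_conjugacyCoeff_le hlam hroot hc k⟩
end

section
/- Let λ ∈ ℂ_p with |λ| = 1 and λ not a root of unity, and let m, s, γ₀, t be as defined. Then for every integer n ≥ 1: (1) if m does not divide n, then |1 - λ^n| = 1; (2) if m divides n and ν(n) < s, then |1 - λ^n| = |1 - λ^m|^{p^{ν(n)}}; (3) if m divides n and ν(n) ≥ s, then |1 - λ^n| = p^t · |n| · |γ₀ - λ^m|^{p^t}; in particular, if |1 - λ^m| ≠ R(s') for every s' ≥ 1, then γ₀ = 1 and t = s. -/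
open scoped BigOperators

open Polynomial

section Ultrametric

variable {K : Type*} [NormedField K] [IsUltrametricDist K]

lemma norm_sub_le_max_norm_sub (x y z : K) : ‖x - z‖ ≤ max ‖x - y‖ ‖y - z‖ := by
  simpa [dist_eq_norm] using dist_triangle_max x y z

lemma norm_sub_eq_of_norm_sub_lt {x y z : K} (h : ‖x - y‖ < ‖y - z‖) : ‖x - z‖ = ‖y - z‖ := by
  have := IsUltrametricDist.norm_add_eq_max_of_norm_ne_norm h.ne
  rwa [sub_add_sub_cancel, max_eq_right h.le] at this

lemma norm_eq_one_of_pow_eq_one {F : Type*} [NormedField F] {x : F} {n : ℕ} (h : x ^ n = 1)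
    (hn : n ≠ 0) : ‖x‖ = 1 :=
  (isOfFinOrder_iff_pow_eq_one.2 ⟨n, Nat.pos_of_ne_zero hn, h⟩).norm_eq_one

lemma norm_one_sub_pow_le {x : K} (hx : ‖x‖ = 1) (n : ℕ) : ‖1 - x ^ n‖ ≤ ‖1 - x‖ := by
  rw [← mul_neg_geom_sum, norm_mul]
  refine mul_le_of_le_one_right (norm_nonneg _) ?_
  exact IsUltrametricDist.norm_sum_le_of_forall_le_of_nonneg zero_le_one (by simp [hx])

lemma norm_one_sub_pow_eq_of_norm_natCast_eq_one {x : K} (hx : ‖x‖ = 1) (hx1 : ‖1 - x‖ < 1) {n : ℕ}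
    (hn : ‖(n : K)‖ = 1) : ‖1 - x ^ n‖ = ‖1 - x‖ := by
  have hsum : ‖∑ i ∈ Finset.range n, x ^ i - (n : K)‖ ≤ ‖1 - x‖ := by
    have : ∑ i ∈ Finset.range n, x ^ i - (n : K) = ∑ i ∈ Finset.range n, (x ^ i - 1) := by simp
    rw [this]
    refine IsUltrametricDist.norm_sum_le_of_forall_le_of_nonneg (norm_nonneg _) fun i _ ↦ ?_
    rw [norm_sub_rev]
    exact norm_one_sub_pow_le hx i
  have := norm_sub_eq_of_norm_sub_lt (x := ∑ i ∈ Finset.range n, x ^ i) (y := (n : K)) (z := 0)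
    (by rw [sub_zero, hn]; exact hsum.trans_lt hx1)
  rw [sub_zero, sub_zero, hn] at this
  rw [← mul_neg_geom_sum, norm_mul, this, mul_one]

lemma norm_one_sub_eq_of_isPrimitiveRoot {n : ℕ} (hn : n ≠ 0) {ζ η : K} (hζ : IsPrimitiveRoot ζ n)
    (hη : IsPrimitiveRoot η n) : ‖1 - ζ‖ = ‖1 - η‖ := by
  have : NeZero n := ⟨hn⟩
  obtain ⟨i, -, rfl⟩ := hζ.eq_pow_of_pow_eq_one hη.pow_eq_one
  obtain ⟨j, -, hj⟩ := hη.eq_pow_of_pow_eq_one hζ.pow_eq_one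
  refine le_antisymm ?_ (norm_one_sub_pow_le (norm_eq_one_of_pow_eq_one hζ.pow_eq_one hn) i)
  conv_lhs => rw [← hj]
  exact norm_one_sub_pow_le (norm_eq_one_of_pow_eq_one hη.pow_eq_one hn) j

/-- If `lam ^ m` is the first power of `lam` in the open unit ball about `1`, then only the powers
of `lam ^ m` lie in that ball. -/
lemma norm_one_sub_pow_eq_one_of_not_dvd {lam : K} (hlam : ‖lam‖ = 1) {m : ℕ}
    (hm : IsLeast {n : ℕ | 1 ≤ n ∧ ‖1 - lam ^ n‖ < 1} m) {n : ℕ} (hmn : ¬ m ∣ n) :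
    ‖1 - lam ^ n‖ = 1 := by
  have hpow (x : K) (hx : ‖x‖ = 1) : ‖1 - x‖ ≤ 1 := by
    simpa [hx] using norm_sub_le_max_norm_sub 1 0 x
  refine (hpow _ (by simp [hlam])).eq_of_not_lt fun hlt ↦ ?_
  have hr : 1 ≤ n % m := by
    have := mt Nat.dvd_of_mod_eq_zero hmn
    omega
  have hq : ‖1 - (lam ^ m) ^ (n / m)‖ < 1 :=
    (norm_one_sub_pow_le (by simp [hlam]) _).trans_lt hm.1.2
  have hsplit : lam ^ n = lam ^ (n % m) * (lam ^ m) ^ (n / m) := by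
    rw [← pow_mul, ← pow_add, Nat.mod_add_div]
  have hdiff : ‖lam ^ n - lam ^ (n % m)‖ < 1 := by
    rw [hsplit, ← mul_sub_one, norm_mul, norm_sub_rev]
    simpa [hlam] using hq
  have hmem : ‖1 - lam ^ (n % m)‖ < 1 :=
    (norm_sub_le_max_norm_sub _ (lam ^ n) _).trans_lt (max_lt hlt hdiff)
  exact absurd (hm.2 ⟨hr, hmem⟩) (not_le.2 (Nat.mod_lt _ hm.1.1))

end Ultrametric

section RootsOfUnity

variable {K : Type*} [NormedField K] [CharZero K] [IsAlgClosed K]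

/-- If every `n`-th root of unity is as far from `x` as `1` is, then `‖1 - x ^ n‖` is a power of
that common distance. -/
lemma norm_one_sub_pow_eq_pow {n : ℕ} (hn : n ≠ 0) {x : K}
    (h : ∀ ζ : K, ζ ^ n = 1 → ‖ζ - x‖ = ‖1 - x‖) : ‖1 - x ^ n‖ = ‖1 - x‖ ^ n := by
  have : NeZero (n : K) := ⟨Nat.cast_ne_zero.2 hn⟩
  obtain ⟨ζ, hζ⟩ := HasEnoughRootsOfUnity.exists_primitiveRoot K n
  have hprod := congrArg (fun f ↦ ‖f.eval x‖)
    (X_pow_sub_one_eq_prod (Nat.pos_of_ne_zero hn) hζ)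
  simp only [eval_sub, eval_pow, eval_X, eval_one, eval_prod, eval_C, norm_prod] at hprod
  rw [norm_sub_rev, hprod]
  conv_rhs => rw [← hζ.card_nthRootsFinset]
  refine Finset.prod_eq_pow_card fun η hη ↦ ?_
  rw [norm_sub_rev]
  exact h η ((mem_nthRootsFinset (Nat.pos_of_ne_zero hn) 1).1 hη)

lemma norm_eval_cyclotomic {n : ℕ} (hn : n ≠ 0) (x : K) :
    ‖(cyclotomic n K).eval x‖ = ∏ ζ ∈ primitiveRoots n K, ‖ζ - x‖ := by
  have : NeZero (n : K) := ⟨Nat.cast_ne_zero.2 hn⟩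
  obtain ⟨ζ, hζ⟩ := HasEnoughRootsOfUnity.exists_primitiveRoot K n
  simp [cyclotomic_eq_prod_X_sub_primitiveRoots hζ, eval_prod, norm_sub_rev x]

variable {p : ℕ} [Fact p.Prime]

lemma norm_one_sub_pow_prime_pow_succ {k : ℕ} {x : K}
    (h : ∀ ζ : K, IsPrimitiveRoot ζ (p ^ (k + 1)) → ‖ζ - x‖ = ‖ζ - 1‖) :
    ‖1 - x ^ p ^ (k + 1)‖ = ‖(p : K)‖ * ‖1 - x ^ p ^ k‖ := by
  have hne : p ^ (k + 1) ≠ 0 := pow_ne_zero _ (Fact.out : p.Prime).ne_zero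
  have hmul := congrArg (fun f ↦ ‖f.eval x‖) (cyclotomic_prime_pow_mul_X_pow_sub_one K p k)
  simp only [eval_mul, eval_sub, eval_pow, eval_X, eval_one, norm_mul] at hmul
  rw [norm_sub_rev, ← hmul, norm_sub_rev 1, norm_eval_cyclotomic hne,
    ← eval_one_cyclotomic_prime_pow (R := K) k, norm_eval_cyclotomic hne]
  congr 1
  exact Finset.prod_congr rfl fun ζ hζ ↦ h ζ (isPrimitiveRoot_of_mem_primitiveRoots hζ)

end RootsOfUnity

section Radii

variable (p : ℕ) [Fact p.Prime]

lemma Rr_strictMono : StrictMono (Rr p) := by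
  have hp : (1 : ℝ) < p := by exact_mod_cast (Fact.out : p.Prime).one_lt
  refine strictMono_nat_of_lt_succ fun k ↦ ?_
  rcases k with _ | k
  · simpa [Rr] using Real.rpow_pos_of_pos (zero_lt_one.trans hp) _
  · simp only [Rr, Nat.add_eq_zero_iff, one_ne_zero, and_false, if_false, Nat.add_sub_cancel]
    rw [Real.rpow_lt_rpow_left_iff hp, neg_div, neg_div, neg_lt_neg_iff]
    have h1 : (0 : ℝ) < (p : ℝ) - 1 := sub_pos.2 hp
    exact one_div_lt_one_div_of_lt (by positivity)
      (mul_lt_mul_of_pos_right (pow_lt_pow_right₀ hp k.lt_succ_self) h1)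

lemma Rr_lt_one (k : ℕ) : Rr p k < 1 := by
  have hp : (1 : ℝ) < p := by exact_mod_cast (Fact.out : p.Prime).one_lt
  rcases k with _ | k
  · simp [Rr]
  · simp only [Rr, Nat.add_eq_zero_iff, one_ne_zero, and_false, if_false, Nat.add_sub_cancel]
    refine Real.rpow_lt_one_of_one_lt_of_neg hp (div_neg_of_neg_of_pos (by norm_num) ?_)
    have h1 : (0 : ℝ) < (p : ℝ) - 1 := sub_pos.2 hp
    positivity

variable {p}

variable {K : Type*} [NormedField K] [IsUltrametricDist K] [CharZero K] [IsAlgClosed K]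

lemma norm_one_sub_eq_Rr (hp : ‖(p : K)‖ = (p : ℝ)⁻¹) {k : ℕ} {ζ : K}
    (hζ : IsPrimitiveRoot ζ (p ^ k)) : ‖1 - ζ‖ = Rr p k := by
  have hp1 : (1 : ℝ) < p := by exact_mod_cast (Fact.out : p.Prime).one_lt
  have h1 : (0 : ℝ) < (p : ℝ) - 1 := sub_pos.2 hp1
  rcases k with _ | k
  · simp only [pow_zero, IsPrimitiveRoot.one_right_iff] at hζ
    simp [hζ, Rr]
  · have hne : p ^ (k + 1) ≠ 0 := pow_ne_zero _ (Fact.out : p.Prime).ne_zero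
    have hpow : ‖1 - ζ‖ ^ (p ^ k * (p - 1)) = (p : ℝ)⁻¹ := by
      rw [← hp, ← eval_one_cyclotomic_prime_pow (R := K) k, norm_eval_cyclotomic hne,
        ← Nat.totient_prime_pow_succ Fact.out, ← hζ.card_primitiveRoots]
      refine (Finset.prod_eq_pow_card fun η hη ↦ ?_).symm
      rw [norm_sub_rev]
      exact norm_one_sub_eq_of_isPrimitiveRoot hne (isPrimitiveRoot_of_mem_primitiveRoots hη) hζ
    have hexp : ((p ^ k * (p - 1) : ℕ) : ℝ) = (p : ℝ) ^ k * ((p : ℝ) - 1) := by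
      push_cast [Nat.cast_sub (Fact.out : p.Prime).one_le]
      rfl
    have hpos : (0 : ℝ) < (p : ℝ) ^ k * ((p : ℝ) - 1) := by positivity
    rw [← Real.rpow_natCast, hexp] at hpow
    simp only [Rr, Nat.add_eq_zero_iff, one_ne_zero, and_false, if_false, Nat.add_sub_cancel]
    rw [neg_div, Real.rpow_neg (by positivity), ← Real.inv_rpow (by positivity), ← hpow,
      ← Real.rpow_mul (norm_nonneg _), mul_one_div_cancel hpos.ne', Real.rpow_one]

lemma exists_isPrimitiveRoot_of_pow_prime_pow_eq_one {M : Type*} [CommMonoid M] {ζ : M} {k : ℕ}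
    (h : ζ ^ p ^ k = 1) : ∃ j ≤ k, IsPrimitiveRoot ζ (p ^ j) := by
  obtain ⟨j, hjk, hj⟩ := (Nat.dvd_prime_pow Fact.out).1 (orderOf_dvd_of_pow_eq_one h)
  exact ⟨j, hjk, hj ▸ IsPrimitiveRoot.orderOf ζ⟩

lemma norm_one_sub_le_Rr (hp : ‖(p : K)‖ = (p : ℝ)⁻¹) {k : ℕ} {ζ : K} (h : ζ ^ p ^ k = 1) :
    ‖1 - ζ‖ ≤ Rr p k := by
  obtain ⟨j, hjk, hj⟩ := exists_isPrimitiveRoot_of_pow_prime_pow_eq_one h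
  exact (norm_one_sub_eq_Rr hp hj).trans_le ((Rr_strictMono p).monotone hjk)

/-- The first power of `lam` in the open unit ball about `1` has exponent prime to `p`. -/
lemma not_dvd_of_isLeast (hp : ‖(p : K)‖ = (p : ℝ)⁻¹) {lam : K} (hlam : ‖lam‖ = 1) {m : ℕ}
    (hm : IsLeast {n : ℕ | 1 ≤ n ∧ ‖1 - lam ^ n‖ < 1} m) : ¬ p ∣ m := by
  rintro ⟨d, rfl⟩
  have hd : 1 ≤ d := Nat.pos_of_ne_zero fun h ↦ by simpa [h] using hm.1.1
  have hpd : ¬ p * d ∣ d := fun h ↦ by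
    have := Nat.le_of_dvd hd h
    nlinarith [(Fact.out : p.Prime).two_le]
  have hone := norm_one_sub_pow_eq_one_of_not_dvd hlam hm hpd
  have hpow := norm_one_sub_pow_eq_pow (Fact.out : p.Prime).ne_zero (x := lam ^ d) fun ζ hζ ↦
    norm_sub_eq_of_norm_sub_lt <| by
      rw [hone, norm_sub_rev]
      exact (norm_one_sub_le_Rr hp (k := 1) (by simpa using hζ)).trans_lt (Rr_lt_one p 1)
  have hlt := hm.1.2
  rw [mul_comm, pow_mul, hpow, hone, one_pow] at hlt
  exact lt_irrefl _ hlt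

/-- If `1` is a closest `p`-power root of unity to `x`, and `t` locates `‖1 - x‖` among the radii,
then `‖1 - x ^ p ^ a‖` decays by a factor `p` at every step from `t` on. -/
lemma norm_one_sub_pow_prime_pow_of_closest (hp : ‖(p : K)‖ = (p : ℝ)⁻¹) {x : K} {t : ℕ}
    (hmax : ∀ ζ ∈ GammaR p K, ‖ζ - x‖ = max ‖ζ - 1‖ ‖1 - x‖)
    (ht : Rr p t ≤ ‖1 - x‖ ∧ ‖1 - x‖ < Rr p (t + 1)) {a : ℕ} (hta : t ≤ a) :
    ‖1 - x ^ p ^ a‖ = (p : ℝ) ^ t * ((p : ℝ) ^ a)⁻¹ * ‖1 - x‖ ^ p ^ t := by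
  have hp0 : (p : ℝ) ≠ 0 := Nat.cast_ne_zero.2 (Fact.out : p.Prime).ne_zero
  induction a, hta using Nat.le_induction with
  | base =>
    rw [mul_inv_cancel₀ (pow_ne_zero _ hp0), one_mul]
    refine norm_one_sub_pow_eq_pow (pow_ne_zero _ (Fact.out : p.Prime).ne_zero) fun ζ hζ ↦ ?_
    rw [hmax ζ ⟨t, hζ⟩, max_eq_right]
    rw [norm_sub_rev]
    exact (norm_one_sub_le_Rr hp hζ).trans ht.1
  | succ a hta ih =>
    rw [norm_one_sub_pow_prime_pow_succ fun ζ hζ ↦ ?_, ih, hp, pow_succ, mul_inv]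
    · ring
    · rw [hmax ζ ⟨a + 1, hζ.pow_eq_one⟩, max_eq_left]
      rw [norm_sub_rev ζ, norm_one_sub_eq_Rr hp hζ]
      exact ht.2.le.trans ((Rr_strictMono p).monotone (by omega))

end Radii

/-- Lemma on the arithmetic of the multiplier. For `n ≥ 1`:
if `m ∤ n` then `|1-λ^n| = 1`; if `m ∣ n` and `ν(n) < s` then
`|1-λ^n| = |1-λ^m|^{p^{ν(n)}}`; if `m ∣ n` and `ν(n) ≥ s` then
`|1-λ^n| = p^t·|n|·|γ₀-λ^m|^{p^t}`; and if `|1-λ^m| ≠ R(s')` for all `s' ≥ 1`, then `γ₀`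
may be taken to be `1` and `t = s`. -/
theorem stmt6 (p : ℕ) [Fact p.Prime]
    {K : Type*} [NontriviallyNormedField K] [IsUltrametricDist K] [CompleteSpace K]
    [IsAlgClosed K] [Algebra ℚ_[p] K]
    (hiso : ∀ x : ℚ_[p], ‖algebraMap ℚ_[p] K x‖ = ‖x‖)
    (hdense : Dense {x : K | IsAlgebraic ℚ_[p] x})
    (lam : K) (hlam : ‖lam‖ = 1) (hroot : ∀ n : ℕ, 1 ≤ n → lam ^ n ≠ 1)
    (m : ℕ) (hm : IsLeast {n : ℕ | 1 ≤ n ∧ ‖1 - lam ^ n‖ < 1} m)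
    (s : ℕ) (hs : Rr p s ≤ ‖1 - lam ^ m‖ ∧ ‖1 - lam ^ m‖ < Rr p (s + 1))
    (γ₀ : K) (hγ₀ : γ₀ ∈ GammaR p K)
    (hγmin : ∀ γ ∈ GammaR p K, ‖γ₀ - lam ^ m‖ ≤ ‖γ - lam ^ m‖)
    (t : ℕ) (ht : Rr p t ≤ ‖γ₀ - lam ^ m‖ ∧ ‖γ₀ - lam ^ m‖ < Rr p (t + 1))
 :
    (∀ n : ℕ, 1 ≤ n →
      (¬ (m ∣ n) → ‖1 - lam ^ n‖ = 1) ∧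
      ((m ∣ n) → padicValNat p n < s →
        ‖1 - lam ^ n‖ = ‖1 - lam ^ m‖ ^ (p ^ padicValNat p n : ℕ)) ∧
      ((m ∣ n) → s ≤ padicValNat p n →
        ‖1 - lam ^ n‖ = (p : ℝ) ^ t * ‖(n : K)‖ * ‖γ₀ - lam ^ m‖ ^ (p ^ t : ℕ))) ∧
    ((∀ s' : ℕ, 1 ≤ s' → ‖1 - lam ^ m‖ ≠ Rr p s') →
      ‖γ₀ - lam ^ m‖ = ‖1 - lam ^ m‖ ∧ t = s) := by
  have hpr : p.Prime := Fact.out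
  have : CharZero K := charZero_of_injective_algebraMap (algebraMap ℚ_[p] K).injective
  have hnat (n : ℕ) : ‖(n : K)‖ = ‖(n : ℚ_[p])‖ := by rw [← hiso, map_natCast]
  have hp : ‖(p : K)‖ = (p : ℝ)⁻¹ := by rw [hnat, Padic.norm_p]
  have hmu : ‖lam ^ m‖ = 1 := by simp [hlam]
  have hpm := not_dvd_of_isLeast hp hlam hm
  have hred {n : ℕ} (hn : 1 ≤ n) (hmn : m ∣ n) :
      ‖1 - lam ^ n‖ = ‖1 - (lam ^ m) ^ p ^ padicValNat p n‖ := by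
    obtain ⟨q, rfl⟩ := hmn
    have hm0 : m ≠ 0 := by rintro rfl; simp at hn
    have hq0 : q ≠ 0 := by rintro rfl; simp at hn
    rw [padicValNat.mul hm0 hq0, padicValNat.eq_zero_of_not_dvd hpm, zero_add, pow_mul]
    obtain ⟨u, hu⟩ := pow_padicValNat_dvd (p := p) (n := q)
    have hpu : ¬ p ∣ u := by
      rintro ⟨v, rfl⟩
      exact pow_succ_padicValNat_not_dvd hq0 ⟨v, hu.trans (by ring)⟩
    conv_lhs => rw [hu, pow_mul]
    refine norm_one_sub_pow_eq_of_norm_natCast_eq_one (by simp [hlam])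
      ((norm_one_sub_pow_le hmu _).trans_lt hm.1.2) ?_
    rw [hnat, Padic.norm_natCast_eq_one_iff]
    exact (hpr.coprime_iff_not_dvd).2 hpu
  have hmono := Rr_strictMono p
  have hclose : ‖γ₀ - lam ^ m‖ ≤ ‖1 - lam ^ m‖ := hγmin 1 ⟨0, by simp⟩
  refine ⟨fun n hn ↦ ⟨norm_one_sub_pow_eq_one_of_not_dvd hlam hm, fun hmn hlt ↦ ?_,
    fun hmn hle ↦ ?_⟩, fun hne ↦ ?_⟩
  · rw [hred hn hmn]
    refine norm_one_sub_pow_eq_pow (pow_ne_zero _ hpr.ne_zero) fun ζ hζ ↦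
      norm_sub_eq_of_norm_sub_lt ?_
    rw [norm_sub_rev]
    exact (norm_one_sub_le_Rr hp hζ).trans_lt ((hmono hlt).trans_le hs.1)
  · obtain ⟨k, hk⟩ := hγ₀
    obtain ⟨j, -, hj⟩ := exists_isPrimitiveRoot_of_pow_prime_pow_eq_one hk
    have hjs : j ≤ s := by
      refine Nat.lt_succ_iff.1 (hmono.lt_iff_lt.1 ?_)
      rw [← norm_one_sub_eq_Rr hp hj]
      refine ((norm_sub_le_max_norm_sub _ (lam ^ m) _).trans ?_).trans_lt hs.2
      rw [norm_sub_rev _ γ₀]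
      exact max_le le_rfl hclose
    have hts : t ≤ s :=
      Nat.lt_succ_iff.1 (hmono.lt_iff_lt.1 (ht.1.trans_lt (hclose.trans_lt hs.2)))
    have hγ1 : ‖γ₀‖ = 1 := norm_eq_one_of_pow_eq_one hk (pow_ne_zero _ hpr.ne_zero)
    have hγ0 : γ₀ ≠ 0 := norm_ne_zero_iff.1 (by simp [hγ1])
    have hshift (ζ : K) : ‖ζ - lam ^ m / γ₀‖ = ‖ζ * γ₀ - lam ^ m‖ := by
      rw [← mul_one ‖ζ - _‖, ← hγ1, ← norm_mul, sub_mul, div_mul_cancel₀ _ hγ0]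
    have hγa : γ₀ ^ p ^ padicValNat p n = 1 :=
      (hj.pow_eq_one_iff_dvd _).2 (pow_dvd_pow p (hjs.trans hle))
    have hmax : ∀ ζ ∈ GammaR p K,
        ‖ζ - lam ^ m / γ₀‖ = max ‖ζ - 1‖ ‖1 - lam ^ m / γ₀‖ := by
      rintro ζ ⟨i, hi⟩
      have hζγ : ζ * γ₀ ∈ GammaR p K := by
        refine ⟨i + k, ?_⟩
        rw [mul_pow, pow_add, pow_mul, hi, one_pow, one_mul, mul_comm, pow_mul, hk, one_pow]
      refine le_antisymm (norm_sub_le_max_norm_sub _ _ _) ?_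
      have hle : ‖1 - lam ^ m / γ₀‖ ≤ ‖ζ - lam ^ m / γ₀‖ := by
        rw [hshift, hshift, one_mul]
        exact hγmin _ hζγ
      refine max_le ((norm_sub_le_max_norm_sub _ (lam ^ m / γ₀) _).trans (max_le le_rfl ?_)) hle
      rwa [norm_sub_rev]
    have hd : ‖1 - lam ^ m / γ₀‖ = ‖γ₀ - lam ^ m‖ := by rw [hshift, one_mul]
    have hmain := norm_one_sub_pow_prime_pow_of_closest hp hmax (by rwa [hd]) (hts.trans hle)
    rw [div_pow, hγa, div_one, hd] at hmain
    rw [hred hn hmn, hmain, hnat,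
      Padic.norm_eq_zpow_neg_valuation (Nat.cast_ne_zero.2 (by omega)), Padic.valuation_natCast,
      zpow_neg, zpow_natCast]
  · have heq : ‖γ₀ - lam ^ m‖ = ‖1 - lam ^ m‖ := by
      refine hclose.antisymm ?_
      obtain ⟨k, hk⟩ := hγ₀
      obtain ⟨j, -, hj⟩ := exists_isPrimitiveRoot_of_pow_prime_pow_eq_one hk
      rcases j with _ | j
      · simp only [pow_zero, IsPrimitiveRoot.one_right_iff] at hj
        rw [hj]
      have hneq : ‖γ₀ - 1‖ ≠ ‖1 - lam ^ m‖ := by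
        rw [norm_sub_rev, norm_one_sub_eq_Rr hp hj]
        exact (hne (j + 1) (by omega)).symm
      have := IsUltrametricDist.norm_add_eq_max_of_norm_ne_norm hneq
      rw [sub_add_sub_cancel] at this
      exact this ▸ le_max_right _ _
    rw [heq] at ht
    refine ⟨heq, le_antisymm ?_ ?_⟩
    · exact Nat.lt_succ_iff.1 (hmono.lt_iff_lt.1 (ht.1.trans_lt hs.2))
    · exact Nat.lt_succ_iff.1 (hmono.lt_iff_lt.1 (hs.1.trans_lt ht.2))
end

section
/- Let λ ∈ ℂ_p with |λ| = 1 and λ not a root of unity, and suppose m = 1. Let k ≥ 2 be an integer such that p^s does not divide k-1 (so that s ≥ 1). Then ( Π_{n=1}^{k-1} |1 - λ^n| )^{-1} ≤ R(s+1) · |1 - λ|^{(k-1)/p - ⌊(k-1)/p⌋} · r̃(λ)^{-(k-1)}. -/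
open scoped BigOperators

section Norms

variable {K : Type*} [NontriviallyNormedField K] [IsUltrametricDist K]

lemma norm_eq_one_of_norm_one_sub_lt {μ : K} (h : ‖1 - μ‖ < 1) : ‖μ‖ = 1 := by
  have hne : ‖(1 : K)‖ ≠ ‖-(1 - μ)‖ := by
    rw [norm_one, norm_neg]
    exact h.ne'
  have key := IsUltrametricDist.norm_add_eq_max_of_norm_ne_norm hne
  rw [norm_neg, norm_one, max_eq_left h.le] at key
  rw [← key]
  congr 1
  ring

lemma norm_pow_sub_one_le {μ : K} (h : ‖μ‖ ≤ 1) (n : ℕ) : ‖μ ^ n - 1‖ ≤ ‖μ - 1‖ := by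
  rw [← mul_geom_sum, norm_mul]
  refine mul_le_of_le_one_right (norm_nonneg _) ?_
  refine IsUltrametricDist.norm_sum_le_of_forall_le_of_nonneg zero_le_one fun i _ => ?_
  rw [norm_pow]
  exact pow_le_one₀ (norm_nonneg _) h

lemma norm_one_sub_pow_of_norm_natCast {μ : K} (h : ‖1 - μ‖ < 1) {n : ℕ}
    (hn : ‖(n : K)‖ = 1) : ‖1 - μ ^ n‖ = ‖1 - μ‖ := by
  have hμ := norm_eq_one_of_norm_one_sub_lt h
  have hsum : ‖∑ i ∈ Finset.range n, (μ ^ i - 1)‖ ≤ ‖μ - 1‖ :=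
    IsUltrametricDist.norm_sum_le_of_forall_le_of_nonneg (norm_nonneg _)
      fun i _ => norm_pow_sub_one_le hμ.le i
  rw [norm_sub_rev] at h
  have hlt := hsum.trans_lt h
  have hgeom : ‖∑ i ∈ Finset.range n, μ ^ i‖ = 1 := by
    have hne : ‖(n : K)‖ ≠ ‖∑ i ∈ Finset.range n, (μ ^ i - 1)‖ := by
      rw [hn]
      exact hlt.ne'
    have key := IsUltrametricDist.norm_add_eq_max_of_norm_ne_norm hne
    rw [hn, max_eq_left hlt.le] at key
    rw [← key, Finset.sum_sub_distrib]
    simp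
  rw [norm_sub_rev, ← mul_geom_sum, norm_mul, hgeom, mul_one, norm_sub_rev]

variable {p : ℕ} [hpr : Fact p.Prime]

/-- Binomial expansion of `(1 + z) ^ p - 1`, with the linear term factored out. -/
lemma exists_one_add_pow_prime_sub_one {z : K} (hz : ‖z‖ ≤ 1) :
    ∃ S : K, (1 + z) ^ p - 1 = z ^ p + p * z * S ∧ ‖S - 1‖ ≤ ‖z‖ := by
  have hp1 := hpr.out.one_lt
  refine ⟨∑ k ∈ Finset.Ioo 0 p, z ^ (k - 1) * 1 ^ (p - k - 1) * ((p.choose k / p : ℕ) : K),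
    by rw [add_comm, add_pow_prime_eq hpr.out z 1, one_pow, mul_one]; ring, ?_⟩
  have hone : (1 : ℕ) ∈ Finset.Ioo 0 p := Finset.mem_Ioo.2 ⟨one_pos, hp1⟩
  rw [← Finset.add_sum_erase _ _ hone]
  simp only [one_pow, Nat.sub_self, pow_zero, mul_one, Nat.choose_one_right,
    Nat.div_self hpr.out.pos, Nat.cast_one, add_sub_cancel_left]
  refine IsUltrametricDist.norm_sum_le_of_forall_le_of_nonneg (norm_nonneg _) fun i hi => ?_
  obtain ⟨hi1, hi⟩ := Finset.mem_erase.1 hi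
  have hi0 := (Finset.mem_Ioo.1 hi).1
  rw [norm_mul, norm_pow]
  refine (mul_le_of_le_one_right (by positivity)
    (IsUltrametricDist.norm_natCast_le_one K _)).trans ?_
  exact pow_le_of_le_one (norm_nonneg _) hz (by omega)

lemma norm_one_sub_pow_prime_le (hp : ‖(p : K)‖ = (p : ℝ)⁻¹) {μ : K} (h : ‖1 - μ‖ ≤ 1) :
    ‖1 - μ ^ p‖ ≤ max (‖1 - μ‖ ^ p) (‖1 - μ‖ * (p : ℝ)⁻¹) := by
  rw [norm_sub_rev] at h
  obtain ⟨S, hS, hS1⟩ := exists_one_add_pow_prime_sub_one (p := p) h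
  have hSle : ‖S‖ ≤ 1 := by
    have := IsUltrametricDist.norm_add_le_max (S - 1) 1
    rw [sub_add_cancel, norm_one] at this
    exact this.trans (max_le (hS1.trans h) le_rfl)
  rw [norm_sub_rev, norm_sub_rev 1 μ, ← add_sub_cancel 1 μ, hS, add_sub_cancel]
  refine (IsUltrametricDist.norm_add_le_max _ _).trans (max_le_max (norm_pow _ _).le ?_)
  rw [norm_mul, norm_mul, hp, mul_comm (p : ℝ)⁻¹]
  exact mul_le_of_le_one_right (by positivity) hSle

lemma norm_one_sub_pow_prime_eq_pow (hp : ‖(p : K)‖ = (p : ℝ)⁻¹) {μ : K} (h : ‖1 - μ‖ ≤ 1)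
    (hlt : ‖1 - μ‖ * (p : ℝ)⁻¹ < ‖1 - μ‖ ^ p) : ‖1 - μ ^ p‖ = ‖1 - μ‖ ^ p := by
  rw [norm_sub_rev] at h
  rw [norm_sub_rev 1 μ] at hlt
  obtain ⟨S, hS, hS1⟩ := exists_one_add_pow_prime_sub_one (p := p) h
  have hSle : ‖S‖ ≤ 1 := by
    have := IsUltrametricDist.norm_add_le_max (S - 1) 1
    rw [sub_add_cancel, norm_one] at this
    exact this.trans (max_le (hS1.trans h) le_rfl)
  have hsmall : ‖(p : K) * (μ - 1) * S‖ < ‖(μ - 1) ^ p‖ := by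
    rw [norm_mul, norm_mul, hp, mul_comm (p : ℝ)⁻¹, norm_pow]
    exact (mul_le_of_le_one_right (by positivity) hSle).trans_lt hlt
  have key := IsUltrametricDist.norm_add_eq_max_of_norm_ne_norm hsmall.ne'
  rw [max_eq_left hsmall.le, ← hS, add_sub_cancel, norm_pow] at key
  rw [norm_sub_rev, key, norm_sub_rev]

lemma norm_one_sub_pow_prime_eq_mul (hp : ‖(p : K)‖ = (p : ℝ)⁻¹) {μ : K} (h : ‖1 - μ‖ < 1)
    (hlt : ‖1 - μ‖ ^ p < ‖1 - μ‖ * (p : ℝ)⁻¹) : ‖1 - μ ^ p‖ = ‖1 - μ‖ * (p : ℝ)⁻¹ := by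
  rw [norm_sub_rev] at h
  rw [norm_sub_rev 1 μ] at hlt
  obtain ⟨S, hS, hS1⟩ := exists_one_add_pow_prime_sub_one (p := p) h.le
  have hSone : ‖S‖ = 1 :=
    norm_eq_one_of_norm_one_sub_lt (by rw [norm_sub_rev]; exact hS1.trans_lt h)
  have hbig : ‖(p : K) * (μ - 1) * S‖ = ‖μ - 1‖ * (p : ℝ)⁻¹ := by
    rw [norm_mul, norm_mul, hp, hSone]
    ring
  have hsmall : ‖(μ - 1) ^ p‖ < ‖(p : K) * (μ - 1) * S‖ := by
    rw [hbig, norm_pow]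
    exact hlt
  have key := IsUltrametricDist.norm_add_eq_max_of_norm_ne_norm hsmall.ne
  rw [max_eq_right hsmall.le, ← hS, add_sub_cancel, hbig] at key
  rw [norm_sub_rev, key, norm_sub_rev]

lemma mul_inv_lt_pow_iff {c : ℝ} (hc : 0 < c) :
    c * (p : ℝ)⁻¹ < c ^ p ↔ (p : ℝ)⁻¹ < c ^ (p - 1) := by
  rw [← mul_pow_sub_one hpr.out.ne_zero, mul_lt_mul_iff_right₀ hc]

lemma pow_lt_mul_inv_iff {c : ℝ} (hc : 0 < c) :
    c ^ p < c * (p : ℝ)⁻¹ ↔ c ^ (p - 1) < (p : ℝ)⁻¹ := by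
  rw [← mul_pow_sub_one hpr.out.ne_zero, mul_lt_mul_iff_right₀ hc]

lemma inv_prime_lt_one : (p : ℝ)⁻¹ < 1 :=
  inv_lt_one_of_one_lt₀ (by exact_mod_cast hpr.out.one_lt)

lemma lt_one_of_pow_lt_inv_prime {c : ℝ} {n : ℕ} (h : c ^ n < (p : ℝ)⁻¹) : c < 1 := by
  by_contra! hc
  exact absurd (h.trans inv_prime_lt_one) (one_le_pow₀ hc).not_gt

lemma norm_one_sub_pow_prime_of_small (hp : ‖(p : K)‖ = (p : ℝ)⁻¹) {μ : K}
    (h : ‖1 - μ‖ ^ (p - 1) < (p : ℝ)⁻¹) : ‖1 - μ ^ p‖ = ‖1 - μ‖ * (p : ℝ)⁻¹ := by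
  rcases (norm_nonneg (1 - μ)).eq_or_lt with h0 | h0
  · have hμ : μ = 1 := (sub_eq_zero.1 (norm_eq_zero.1 h0.symm)).symm
    simp [hμ]
  · exact norm_one_sub_pow_prime_eq_mul hp (lt_one_of_pow_lt_inv_prime h)
      ((pow_lt_mul_inv_iff h0).2 h)

/-- Close to `1`, raising to the power `p ^ j` contracts by `p ^ (-j)`. -/
lemma norm_one_sub_pow_prime_pow_of_small (hp : ‖(p : K)‖ = (p : ℝ)⁻¹) {μ : K}
    (h : ‖1 - μ‖ ^ (p - 1) < (p : ℝ)⁻¹) (j : ℕ) :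
    ‖1 - μ ^ p ^ j‖ = ‖1 - μ‖ * (p : ℝ)⁻¹ ^ j := by
  induction j with
  | zero => simp
  | succ j ih =>
    have hle : ‖1 - μ‖ * (p : ℝ)⁻¹ ^ j ≤ ‖1 - μ‖ :=
      mul_le_of_le_one_right (norm_nonneg _) (pow_le_one₀ (by positivity) inv_prime_lt_one.le)
    rw [pow_succ p j, pow_mul, norm_one_sub_pow_prime_of_small hp, ih, pow_succ, mul_assoc]
    rw [ih]
    exact (pow_le_pow_left₀ (by positivity) hle _).trans_lt h

lemma norm_one_sub_pow_prime_pow_lt (hp : ‖(p : K)‖ = (p : ℝ)⁻¹) {j : ℕ} {μ : K}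
    (h : ‖1 - μ‖ ^ (p ^ j * (p - 1)) < (p : ℝ)⁻¹) :
    ‖1 - μ ^ p ^ j‖ ^ (p - 1) < (p : ℝ)⁻¹ := by
  have hpp := hpr.out.one_lt
  induction j generalizing μ with
  | zero => simpa using h
  | succ j ih =>
    have hlt := lt_one_of_pow_lt_inv_prime h
    rw [pow_succ', pow_mul]
    apply ih
    rcases le_max_iff.1 (norm_one_sub_pow_prime_le hp hlt.le) with hle | hle
    · refine (pow_le_pow_left₀ (norm_nonneg _) hle _).trans_lt ?_
      rwa [← pow_mul, ← mul_assoc, ← pow_succ']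
    · have hexp : p ^ j * (p - 1) ≠ 0 :=
        mul_ne_zero (pow_ne_zero _ hpr.out.ne_zero) (by omega)
      have hle' : ‖1 - μ ^ p‖ < (p : ℝ)⁻¹ :=
        hle.trans_lt (mul_lt_of_lt_one_left (by positivity) hlt)
      exact (pow_le_of_le_one (norm_nonneg _) (hle'.le.trans inv_prime_lt_one.le) hexp).trans_lt
        hle'

lemma norm_one_sub_pow_prime_pow_le (hp : ‖(p : K)‖ = (p : ℝ)⁻¹) {μ : K} (h1 : ‖1 - μ‖ ≤ 1)
    {j : ℕ} (h : ∀ i < j, (p : ℝ)⁻¹ ≤ ‖1 - μ‖ ^ (p ^ i * (p - 1))) :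
    ‖1 - μ ^ p ^ j‖ ≤ ‖1 - μ‖ ^ p ^ j := by
  induction j with
  | zero => simp
  | succ j ih =>
    have hj := ih fun i hi => h i (by omega)
    have hone : ‖1 - μ‖ ^ p ^ j ≤ 1 := pow_le_one₀ (norm_nonneg _) h1
    rw [pow_succ p j, pow_mul, pow_mul]
    refine (norm_one_sub_pow_prime_le hp (hj.trans hone)).trans (max_le ?_ ?_)
    · exact pow_le_pow_left₀ (norm_nonneg _) hj _
    · rw [← mul_pow_sub_one hpr.out.ne_zero (‖1 - μ‖ ^ p ^ j), ← pow_mul]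
      exact mul_le_mul hj (h j (by omega)) (by positivity) (by positivity)

lemma norm_one_sub_pow_prime_pow_eq (hp : ‖(p : K)‖ = (p : ℝ)⁻¹) {μ : K} (h0 : 0 < ‖1 - μ‖)
    (h1 : ‖1 - μ‖ ≤ 1) {j : ℕ} (h : ∀ i < j, (p : ℝ)⁻¹ < ‖1 - μ‖ ^ (p ^ i * (p - 1))) :
    ‖1 - μ ^ p ^ j‖ = ‖1 - μ‖ ^ p ^ j := by
  induction j with
  | zero => simp
  | succ j ih =>
    have hj := ih fun i hi => h i (by omega)
    have hone : ‖1 - μ‖ ^ p ^ j ≤ 1 := pow_le_one₀ (norm_nonneg _) h1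
    rw [pow_succ p j, pow_mul, pow_mul, norm_one_sub_pow_prime_eq_pow hp (hj.trans_le hone), hj]
    rw [hj, mul_inv_lt_pow_iff (by positivity), ← pow_mul]
    exact h j (by omega)

end Norms

/-- If every `p`-power root of unity is at distance at least `b` from `μ`, then `1 - μ ^ p ^ t`,
a product of `p ^ t` such distances, has norm at least `b ^ p ^ t`. -/
lemma pow_le_norm_one_sub_pow {p : ℕ} [hpr : Fact p.Prime] {K : Type*}
    [NontriviallyNormedField K] [IsAlgClosed K] {μ : K} {b : ℝ} (hb : 0 ≤ b)
    (h : ∀ γ ∈ GammaR p K, b ≤ ‖γ - μ‖) (t : ℕ) : b ^ p ^ t ≤ ‖1 - μ ^ p ^ t‖ := by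
  have hpos : p ^ t ≠ 0 := pow_ne_zero _ hpr.out.ne_zero
  set P : Polynomial K := Polynomial.X ^ p ^ t - Polynomial.C 1 with hP
  have hmonic : P.Monic := Polynomial.monic_X_pow_sub_C 1 hpos
  have heval := (IsAlgClosed.splits P).eval_eq_prod_roots_of_monic hmonic μ
  have hcard : P.roots.card = p ^ t := by
    rw [IsAlgClosed.card_roots_eq_natDegree, hP, Polynomial.natDegree_X_pow_sub_C]
  have hnorm : ‖1 - μ ^ p ^ t‖ = (P.roots.map fun x => ‖μ - x‖).prod := by
    have hPμ : μ ^ p ^ t - 1 = P.eval μ := by simp [hP]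
    rw [norm_sub_rev, hPμ, heval]
    exact (map_multiset_prod (normHom : K →*₀ ℝ) _).trans (congrArg _ (Multiset.map_map _ _ _))
  rw [hnorm, ← hcard, ← Multiset.prod_replicate, ← Multiset.map_const']
  refine Multiset.prod_map_le_prod_map₀ _ _ (fun _ _ => hb) fun x hx => ?_
  rw [norm_sub_rev]
  refine h x ⟨t, ?_⟩
  have := (Polynomial.mem_roots'.1 hx).2
  simpa [hP, sub_eq_zero] using this

section Counting

lemma card_filter_not_dvd_Icc (p N : ℕ) :
    ((Finset.Icc 1 N).filter fun n => ¬ p ∣ n).card = N - N / p := by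
  have h := Finset.card_filter_add_card_filter_not (s := Finset.Icc 1 N) (fun n => p ∣ n)
  have hdvd := Nat.Ioc_filter_dvd_card_eq_div N p
  rw [← Finset.Icc_add_one_left_eq_Ioc, zero_add] at hdvd
  rw [hdvd, Nat.card_Icc] at h
  omega

variable {p : ℕ} [hpr : Fact p.Prime]

lemma sum_Icc_eq_sum_not_dvd_add_sum_mul (f : ℕ → ℝ) (N : ℕ) :
    ∑ n ∈ Finset.Icc 1 N, f n =
      ∑ n ∈ Finset.Icc 1 N with ¬ p ∣ n, f n + ∑ n ∈ Finset.Icc 1 (N / p), f (p * n) := by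
  have hpos := hpr.out.pos
  rw [← Finset.sum_filter_add_sum_filter_not _ (fun n => p ∣ n), add_comm]
  congr 1
  symm
  refine Finset.sum_bij (fun n _ => p * n) ?_ ?_ ?_ (fun _ _ => rfl)
  · intro n hn
    rw [Finset.mem_Icc, Nat.le_div_iff_mul_le hpos, mul_comm] at hn
    rw [Finset.mem_filter, Finset.mem_Icc]
    exact ⟨⟨Nat.mul_pos hpos hn.1, hn.2⟩, dvd_mul_right p n⟩
  · intro a _ b _ h
    exact Nat.eq_of_mul_eq_mul_left hpos h
  · intro n hn
    rw [Finset.mem_filter, Finset.mem_Icc] at hn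
    obtain ⟨⟨h1, hN⟩, u, rfl⟩ := hn
    refine ⟨u, ?_, rfl⟩
    rw [Finset.mem_Icc, Nat.le_div_iff_mul_le hpos, mul_comm]
    exact ⟨Nat.pos_of_mul_pos_left h1, hN⟩

/-- Inductive step for `sum_Icc_le`, keeping the gain coming from `N % p`. -/
lemma sum_Icc_le_of_sum_mul_le {f : ℕ → ℝ} {α β c : ℝ} {s : ℕ} (hα : 0 ≤ α)
    (hβ : (p : ℝ) ^ (s + 1) * α ≤ β) (hunit : ∀ u, ¬ p ∣ u → f u = α) (N : ℕ)
    (hmul : ∑ n ∈ Finset.Icc 1 (N / p), f (p * n) ≤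
      p * α * s * (N / p : ℕ) * (p - 1) / p + β * (N / p : ℕ) / p ^ s
        + c * (N / p ^ (s + 1) : ℕ)) :
    ∑ n ∈ Finset.Icc 1 N, f n ≤
      α * (s + 1 : ℕ) * N * (p - 1) / p + β * N / p ^ (s + 1) + c * (N / p ^ (s + 1) : ℕ)
        - α * ((N : ℝ) / p - (N / p : ℕ)) := by
  have hp0 : (0 : ℝ) < p := by exact_mod_cast hpr.out.pos
  have hp2 : (2 : ℝ) ≤ p := by exact_mod_cast hpr.out.two_le
  have hdiv : (N : ℝ) = p * (N / p : ℕ) + (N % p : ℕ) := by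
    exact_mod_cast (Nat.div_add_mod N p).symm
  have hle : N / p ≤ N := Nat.div_le_self N p
  rw [sum_Icc_eq_sum_not_dvd_add_sum_mul (p := p),
    Finset.sum_congr rfl fun n hn => hunit n (Finset.mem_filter.1 hn).2,
    Finset.sum_const, card_filter_not_dvd_Icc, nsmul_eq_mul, Nat.cast_sub hle]
  refine (add_le_add_right hmul _).trans ?_
  generalize c * ((N / p ^ (s + 1) : ℕ) : ℝ) = d
  have hf : (0 : ℝ) ≤ (N % p : ℕ) := Nat.cast_nonneg _
  generalize ((N % p : ℕ) : ℝ) = r at *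
  generalize ((N / p : ℕ) : ℝ) = q at *
  rw [hdiv]
  have hβ' : α ≤ β / p ^ (s + 1) := by
    rw [le_div_iff₀ (by positivity), mul_comm]
    exact hβ
  have hgain : 0 ≤ r * (α * s * (p - 1) + α * (p - 2)) / p + r * (β / p ^ (s + 1) - α) := by
    have h1 : 0 ≤ (p : ℝ) - 1 := by linarith
    have h2 : 0 ≤ (p : ℝ) - 2 := by linarith
    have h3 := sub_nonneg.2 hβ'
    positivity
  have hid : α * (s + 1 : ℕ) * (p * q + r) * (p - 1) / p + β * (p * q + r) / p ^ (s + 1) + d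
        - α * ((p * q + r) / p - q)
      = (p * q + r - q) * α + (p * α * s * q * (p - 1) / p + β * q / p ^ s + d)
        + (r * (α * s * (p - 1) + α * (p - 2)) / p + r * (β / p ^ (s + 1) - α)) := by
    push_cast
    field_simp
    ring
  rw [hid]
  linarith

lemma sum_Icc_le {s : ℕ} {f : ℕ → ℝ} {α β c : ℝ} (hα : 0 ≤ α) (hβ : (p : ℝ) ^ s * α ≤ β)
    (hunit : ∀ j < s, ∀ u, ¬ p ∣ u → f (p ^ j * u) = p ^ j * α)
    (hmul : ∀ N : ℕ, ∑ n ∈ Finset.Icc 1 N, f (p ^ s * n) ≤ β * N + c * N) (N : ℕ) :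
    ∑ n ∈ Finset.Icc 1 N, f n ≤
      α * s * N * (p - 1) / p + β * N / p ^ s + c * (N / p ^ s : ℕ) := by
  induction s generalizing f α N with
  | zero => simpa using hmul N
  | succ s ih =>
    have hp0 : (0 : ℝ) < p := by exact_mod_cast hpr.out.pos
    have hrec := ih (f := fun n => f (p * n)) (α := p * α) (by positivity)
      (by rw [← mul_assoc, ← pow_succ]; exact hβ)
      (fun j hj u hu => by
        have := hunit (j + 1) (by omega) u hu
        rw [← mul_assoc, ← pow_succ', this]; ring)
      (fun N => by simpa only [← mul_assoc, ← pow_succ'] using hmul N) (N / p)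
    rw [Nat.div_div_eq_div_mul, ← pow_succ'] at hrec
    have hstep := sum_Icc_le_of_sum_mul_le hα hβ
      (fun u hu => by simpa using hunit 0 (by omega) u hu) N hrec
    have hfrac : (0 : ℝ) ≤ α * ((N : ℝ) / p - (N / p : ℕ)) :=
      mul_nonneg hα (sub_nonneg.2 Nat.cast_div_le)
    linarith

/-- The bound of `sum_Icc_le`, improved for `s > 0` by the fractional part of `N / p`. -/
lemma sum_Icc_le_sub_fract {s : ℕ} {f : ℕ → ℝ} {α β c : ℝ} (hα : 0 ≤ α)
    (hβ : (p : ℝ) ^ (s + 1) * α ≤ β)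
    (hunit : ∀ j < s + 1, ∀ u, ¬ p ∣ u → f (p ^ j * u) = p ^ j * α)
    (hmul : ∀ N : ℕ, ∑ n ∈ Finset.Icc 1 N, f (p ^ (s + 1) * n) ≤ β * N + c * N) (N : ℕ) :
    ∑ n ∈ Finset.Icc 1 N, f n ≤
      α * (s + 1 : ℕ) * N * (p - 1) / p + β * N / p ^ (s + 1) + c * (N / p ^ (s + 1) : ℕ)
        - α * ((N : ℝ) / p - (N / p : ℕ)) := by
  have hrec := sum_Icc_le (p := p) (s := s) (f := fun n => f (p * n)) (α := p * α)
    (β := β) (c := c) (by positivity)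
    (by rw [← mul_assoc, ← pow_succ]; exact hβ)
    (fun j hj u hu => by
      have := hunit (j + 1) (by omega) u hu
      rw [← mul_assoc, ← pow_succ', this]; ring)
    (fun N => by simpa only [← mul_assoc, ← pow_succ'] using hmul N) (N / p)
  rw [Nat.div_div_eq_div_mul, ← pow_succ'] at hrec
  exact sum_Icc_le_of_sum_mul_le hα hβ (fun u hu => by simpa using hunit 0 (by omega) u hu) N hrec

lemma sum_padicValNat_Icc_le (N : ℕ) :
    ∑ n ∈ Finset.Icc 1 N, (padicValNat p n : ℝ) ≤ N / (p - 1) := by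
  have hp1 : (1 : ℝ) < p := by exact_mod_cast hpr.out.one_lt
  have hsum : ∑ n ∈ Finset.Icc 1 N, (padicValNat p n : ℝ) = padicValNat p N.factorial := by
    induction N with
    | zero => simp
    | succ N ih =>
      rw [Finset.sum_Icc_succ_top (by omega), ih, Nat.factorial_succ,
        padicValNat.mul (by omega) (Nat.factorial_ne_zero N)]
      push_cast
      ring
  rw [hsum, le_div_iff₀ (by linarith)]
  have h : (p - 1) * padicValNat p N.factorial ≤ N := by
    rw [sub_one_mul_padicValNat_factorial]
    exact Nat.sub_le _ _
  have h' : (((p - 1) * padicValNat p N.factorial : ℕ) : ℝ) ≤ N := by exact_mod_cast h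
  rw [Nat.cast_mul, Nat.cast_sub hpr.out.one_le, Nat.cast_one] at h'
  linarith

end Counting

section Radii

variable {p : ℕ} [hpr : Fact p.Prime]

lemma Rr_succ_pos (s : ℕ) : 0 < Rr p (s + 1) := by
  have hp0 : (0 : ℝ) < p := by exact_mod_cast hpr.out.pos
  rw [Rr, if_neg s.succ_ne_zero]
  positivity

lemma log_Rr_succ (s : ℕ) :
    Real.log (Rr p (s + 1)) = -(Real.log p / (p ^ s * (p - 1))) := by
  have hp0 : (0 : ℝ) < p := by exact_mod_cast hpr.out.pos
  rw [Rr, if_neg s.succ_ne_zero, Real.log_rpow hp0, Nat.add_sub_cancel]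
  ring

lemma Rr_succ_pow (s : ℕ) : Rr p (s + 1) ^ (p ^ s * (p - 1)) = (p : ℝ)⁻¹ := by
  have hp0 : (0 : ℝ) < p := by exact_mod_cast hpr.out.pos
  have hp1 : (1 : ℝ) < p := by exact_mod_cast hpr.out.one_lt
  have hp1' : (p : ℝ) - 1 ≠ 0 := by linarith
  rw [Rr, if_neg s.succ_ne_zero, ← Real.rpow_natCast, ← Real.rpow_mul hp0.le,
    ← Real.rpow_neg_one]
  congr 1
  rw [Nat.cast_mul, Nat.cast_sub hpr.out.one_le, Nat.cast_pow, Nat.cast_one, Nat.add_sub_cancel]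
  field_simp

lemma pow_lt_inv_of_lt_Rr {c : ℝ} (hc : 0 ≤ c) {s : ℕ} (h : c < Rr p (s + 1)) :
    c ^ (p ^ s * (p - 1)) < (p : ℝ)⁻¹ := by
  have hp1 := hpr.out.one_lt
  rw [← Rr_succ_pow s]
  exact pow_lt_pow_left₀ h hc (mul_ne_zero (pow_ne_zero _ hpr.out.ne_zero) (by omega))

lemma inv_le_pow_of_Rr_succ_le {c : ℝ} {s : ℕ} (h : Rr p (s + 1) ≤ c) :
    (p : ℝ)⁻¹ ≤ c ^ (p ^ s * (p - 1)) := by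
  rw [← Rr_succ_pow s]
  exact pow_le_pow_left₀ (Rr_succ_pos s).le h _

lemma inv_le_pow_of_Rr_le {c : ℝ} (hc : 0 ≤ c) (hc1 : c ≤ 1) {t : ℕ} (h : Rr p t ≤ c) {i : ℕ}
    (hi : i < t) : (p : ℝ)⁻¹ ≤ c ^ (p ^ i * (p - 1)) := by
  obtain ⟨r, rfl⟩ := Nat.exists_eq_add_one.2 (Nat.zero_lt_of_lt hi)
  refine (inv_le_pow_of_Rr_succ_le h).trans (pow_le_pow_of_le_one hc hc1 ?_)
  exact Nat.mul_le_mul_right _ (Nat.pow_le_pow_right hpr.out.pos (by omega))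

lemma inv_lt_pow_of_Rr_le {c : ℝ} (hc : 0 < c) (hc1 : c < 1) {s : ℕ} (h : Rr p (s + 1) ≤ c)
    {i : ℕ} (hi : i < s) : (p : ℝ)⁻¹ < c ^ (p ^ i * (p - 1)) := by
  have hp1 := hpr.out.one_lt
  refine (inv_le_pow_of_Rr_succ_le h).trans_lt (pow_lt_pow_right_of_lt_one₀ hc hc1 ?_)
  exact Nat.mul_lt_mul_of_pos_right (Nat.pow_lt_pow_right hp1 hi) (by omega)

end Radii

section Distances

variable {p : ℕ} [hpr : Fact p.Prime] {K : Type*} [NontriviallyNormedField K]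
  [IsUltrametricDist K]

lemma norm_one_sub_pow_of_small (hp : ‖(p : K)‖ = (p : ℝ)⁻¹)
    (hunit : ∀ u : ℕ, ¬ p ∣ u → ‖(u : K)‖ = 1) {μ : K}
    (h : ‖1 - μ‖ ^ (p - 1) < (p : ℝ)⁻¹) {n : ℕ} (hn : n ≠ 0) :
    ‖1 - μ ^ n‖ = ‖1 - μ‖ * (p : ℝ)⁻¹ ^ padicValNat p n := by
  obtain ⟨e, u, hu, rfl⟩ := Nat.exists_eq_pow_mul_and_not_dvd hn p hpr.out.ne_one
  have hu0 : u ≠ 0 := fun h0 => hu (h0 ▸ dvd_zero p)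
  have hval : padicValNat p (p ^ e * u) = e := by
    rw [padicValNat.mul (pow_ne_zero _ hpr.out.ne_zero) hu0, padicValNat.prime_pow,
      padicValNat.eq_zero_of_not_dvd hu, add_zero]
  have hpow := norm_one_sub_pow_prime_pow_of_small hp h e
  have hlt : ‖1 - μ ^ p ^ e‖ < 1 := by
    rw [hpow]
    exact (mul_le_of_le_one_right (norm_nonneg _)
      (pow_le_one₀ (by positivity) inv_prime_lt_one.le)).trans_lt (lt_one_of_pow_lt_inv_prime h)
  rw [hval, pow_mul, norm_one_sub_pow_of_norm_natCast hlt (hunit u hu), hpow]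

/-- A `p`-power root of unity at distance less than `R (s + 1)` from `1` has order dividing
`p ^ s`. -/
lemma pow_eq_one_of_mem_GammaR (hp : ‖(p : K)‖ = (p : ℝ)⁻¹) {γ : K} (hγ : γ ∈ GammaR p K) {s : ℕ}
    (h : ‖1 - γ‖ < Rr p (s + 1)) : γ ^ p ^ s = 1 := by
  obtain ⟨k, hk⟩ := hγ
  have hsmall := norm_one_sub_pow_prime_pow_lt hp (pow_lt_inv_of_lt_Rr (norm_nonneg _) h)
  have hpow := norm_one_sub_pow_prime_pow_of_small hp hsmall k
  rw [← pow_mul, mul_comm, pow_mul, hk, one_pow, sub_self, norm_zero] at hpow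
  have hp0 : ((p : ℝ)⁻¹) ^ k ≠ 0 :=
    pow_ne_zero _ (inv_ne_zero (by exact_mod_cast hpr.out.ne_zero))
  have hzero := (mul_eq_zero.1 hpow.symm).resolve_right hp0
  exact (sub_eq_zero.1 (norm_eq_zero.1 hzero)).symm

/-- The distance of `lam ^ p ^ s` to `1` in terms of the distance of `lam` to a nearest `p`-power
root of unity. -/
lemma norm_one_sub_pow_eq_of_nearest [IsAlgClosed K] (hp : ‖(p : K)‖ = (p : ℝ)⁻¹) {lam γ₀ : K}
    (hγ₀ : γ₀ ∈ GammaR p K) (hγmin : ∀ γ ∈ GammaR p K, ‖γ₀ - lam‖ ≤ ‖γ - lam‖) {s t : ℕ}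
    (hs : ‖1 - lam‖ < Rr p (s + 1)) (hlam : ‖1 - lam‖ < 1)
    (ht : Rr p t ≤ ‖γ₀ - lam‖ ∧ ‖γ₀ - lam‖ < Rr p (t + 1)) :
    t ≤ s ∧ ‖1 - lam ^ p ^ s‖ = ‖γ₀ - lam‖ ^ p ^ t * (p : ℝ)⁻¹ ^ (s - t) := by
  have hle : ‖γ₀ - lam‖ ≤ ‖1 - lam‖ := hγmin 1 ⟨0, by simp⟩
  have hγ1 : ‖1 - γ₀‖ ≤ ‖1 - lam‖ := by
    have := IsUltrametricDist.norm_add_le_max (1 - lam) (lam - γ₀)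
    rw [sub_add_sub_cancel, norm_sub_rev lam] at this
    exact this.trans (max_le le_rfl hle)
  have hγs := pow_eq_one_of_mem_GammaR hp hγ₀ (hγ1.trans_lt hs)
  have hγnorm : ‖γ₀‖ = 1 := norm_eq_one_of_norm_one_sub_lt (hγ1.trans_lt hlam)
  have hγne : γ₀ ≠ 0 := norm_pos_iff.1 (by rw [hγnorm]; exact one_pos)
  have hts : t ≤ s := by
    by_contra! hst
    have h1 := inv_le_pow_of_Rr_le (norm_nonneg _) (hle.trans hlam.le) ht.1 hst
    have h2 := pow_lt_inv_of_lt_Rr (norm_nonneg _) (hle.trans_lt hs)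
    exact absurd h2 h1.not_gt
  have hdist : ∀ γ : K, ‖γ - lam / γ₀‖ = ‖γ * γ₀ - lam‖ := by
    intro γ
    have : γ * γ₀ - lam = (γ - lam / γ₀) * γ₀ := by field_simp
    rw [this, norm_mul, hγnorm, mul_one]
  have hdist1 : ‖1 - lam / γ₀‖ = ‖γ₀ - lam‖ := by rw [hdist, one_mul]
  have hlow : ‖γ₀ - lam‖ ^ p ^ t ≤ ‖1 - (lam / γ₀) ^ p ^ t‖ := by
    refine pow_le_norm_one_sub_pow (norm_nonneg _) (fun γ hγ => ?_) t
    rw [hdist]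
    obtain ⟨k, hk⟩ := hγ
    refine hγmin _ ⟨k + s, ?_⟩
    rw [mul_pow, pow_add, pow_mul, hk, one_pow, mul_comm (p ^ k), pow_mul, hγs, one_pow, one_mul]
  have hup : ‖1 - (lam / γ₀) ^ p ^ t‖ ≤ ‖γ₀ - lam‖ ^ p ^ t := by
    rw [← hdist1]
    refine norm_one_sub_pow_prime_pow_le hp ?_ fun i hi => ?_
    · rw [hdist1]
      exact hle.trans hlam.le
    · rw [hdist1]
      exact inv_le_pow_of_Rr_le (norm_nonneg _) (hle.trans hlam.le) ht.1 hi
  have hsmall : ‖1 - (lam / γ₀) ^ p ^ t‖ ^ (p - 1) < (p : ℝ)⁻¹ := by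
    refine norm_one_sub_pow_prime_pow_lt hp ?_
    rw [hdist1]
    exact pow_lt_inv_of_lt_Rr (norm_nonneg _) ht.2
  refine ⟨hts, ?_⟩
  have hpow := norm_one_sub_pow_prime_pow_of_small hp hsmall (s - t)
  rw [← pow_mul, ← pow_add, Nat.add_sub_cancel' hts, div_pow, hγs, div_one,
    le_antisymm hup hlow] at hpow
  exact hpow

end Distances

/-- Lemma, the refined product estimate when `m = 1` and `p^s ∤ k-1`.
`(Π_{n=1}^{k-1}|1-λ^n|)⁻¹ ≤ R(s+1)·|1-λ|^{(k-1)/p - ⌊(k-1)/p⌋}·r̃(λ)^{-(k-1)}`. -/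
theorem stmt9 (p : ℕ) [Fact p.Prime]
    {K : Type*} [NontriviallyNormedField K] [IsUltrametricDist K] [CompleteSpace K]
    [IsAlgClosed K] [Algebra ℚ_[p] K]
    (hiso : ∀ x : ℚ_[p], ‖algebraMap ℚ_[p] K x‖ = ‖x‖)
    (hdense : Dense {x : K | IsAlgebraic ℚ_[p] x})
    (lam : K) (hlam : ‖lam‖ = 1) (hroot : ∀ n : ℕ, 1 ≤ n → lam ^ n ≠ 1)
    (m : ℕ) (hm : IsLeast {n : ℕ | 1 ≤ n ∧ ‖1 - lam ^ n‖ < 1} m)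
    (s : ℕ) (hs : Rr p s ≤ ‖1 - lam ^ m‖ ∧ ‖1 - lam ^ m‖ < Rr p (s + 1))
    (γ₀ : K) (hγ₀ : γ₀ ∈ GammaR p K)
    (hγmin : ∀ γ ∈ GammaR p K, ‖γ₀ - lam ^ m‖ ≤ ‖γ - lam ^ m‖)
    (t : ℕ) (ht : Rr p t ≤ ‖γ₀ - lam ^ m‖ ∧ ‖γ₀ - lam ^ m‖ < Rr p (t + 1))
    (hm1 : m = 1) (k : ℕ) (hk : 2 ≤ k) (hnd : ¬ (p ^ s ∣ k - 1)) :
    (∏ n ∈ Finset.Icc 1 (k - 1), ‖1 - lam ^ n‖)⁻¹ ≤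
      Rr p (s + 1) *
        ‖1 - lam‖ ^ ((((k - 1 : ℕ) : ℝ)) / (p : ℝ) - (((k - 1) / p : ℕ) : ℝ)) *
        rTilde p lam γ₀ m s t ^ (-(((k : ℝ) - 1))) := by
  subst hm1
  obtain ⟨N, rfl⟩ : ∃ N, k = N + 1 := ⟨k - 1, by omega⟩
  obtain ⟨r, rfl⟩ : ∃ r, s = r + 1 :=
    Nat.exists_eq_succ_of_ne_zero fun h0 => hnd (by simp [h0])
  simp only [pow_one, Nat.add_sub_cancel] at *
  have hp0 : (0 : ℝ) < p := by exact_mod_cast (Fact.out : p.Prime).pos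
  have hp1 : (1 : ℝ) < p := by exact_mod_cast (Fact.out : p.Prime).one_lt
  have hlogp : 0 < Real.log p := Real.log_pos hp1
  have hp : ‖(p : K)‖ = (p : ℝ)⁻¹ := by
    have := hiso p
    rwa [map_natCast, Padic.norm_p] at this
  have hunit : ∀ u : ℕ, ¬ p ∣ u → ‖(u : K)‖ = 1 := by
    intro u hu
    have := hiso u
    rwa [map_natCast, Padic.norm_natCast_eq_one_iff.2
      ((Nat.Prime.coprime_iff_not_dvd Fact.out).2 hu)] at this
  have hlt : ‖1 - lam‖ < 1 := by simpa using hm.1.2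
  have hne : ∀ n : ℕ, 1 ≤ n → ‖1 - lam ^ n‖ ≠ 0 := fun n hn h0 =>
    hroot n hn (sub_eq_zero.1 (norm_eq_zero.1 h0)).symm
  have ha : 0 < ‖1 - lam‖ := (norm_nonneg _).lt_of_ne' (by simpa using hne 1 le_rfl)
  have hb : 0 < ‖γ₀ - lam‖ := by
    obtain ⟨l, hl⟩ := hγ₀
    refine norm_pos_iff.2 (sub_ne_zero.2 ?_)
    rintro rfl
    exact hroot _ (Nat.one_le_pow _ _ (Fact.out : p.Prime).pos) hl
  obtain ⟨hts, hB⟩ := norm_one_sub_pow_eq_of_nearest hp hγ₀ hγmin hs.2 hlt ht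
  have hBsmall := norm_one_sub_pow_prime_pow_lt hp (pow_lt_inv_of_lt_Rr (norm_nonneg _) hs.2)
  have hBpos : 0 < ‖1 - lam ^ p ^ (r + 1)‖ :=
    (norm_nonneg _).lt_of_ne' (hne _ (Nat.one_le_pow _ _ (Fact.out : p.Prime).pos))
  have hBle : ‖1 - lam ^ p ^ (r + 1)‖ ≤ ‖1 - lam‖ ^ p ^ (r + 1) :=
    norm_one_sub_pow_prime_pow_le hp hlt.le fun i hi =>
      inv_le_pow_of_Rr_le ha.le hlt.le hs.1 hi
  have hlogB : Real.log ‖1 - lam ^ p ^ (r + 1)‖ =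
      p ^ t * Real.log ‖γ₀ - lam‖ - ((r + 1 : ℕ) - t) * Real.log p := by
    rw [hB, Real.log_mul (by positivity) (by positivity), Real.log_pow, Real.log_pow,
      Real.log_inv, Nat.cast_sub hts]
    push_cast
    ring
  have hsum := sum_Icc_le_sub_fract (p := p) (s := r) (f := fun n => -Real.log ‖1 - lam ^ n‖)
    (α := -Real.log ‖1 - lam‖) (β := -Real.log ‖1 - lam ^ p ^ (r + 1)‖)
    (c := Real.log p / (p - 1)) (neg_nonneg.2 (Real.log_nonpos ha.le hlt.le))
    (by
      have := Real.log_le_log hBpos hBle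
      rw [Real.log_pow] at this
      push_cast at this
      linarith)
    (fun j hj u hu => by
      have hpow := norm_one_sub_pow_prime_pow_eq hp ha hlt.le (j := j) fun i hi =>
        inv_lt_pow_of_Rr_le ha hlt hs.1 (by omega)
      have hpowlt : ‖1 - lam ^ p ^ j‖ < 1 := by
        rw [hpow]
        exact pow_lt_one₀ ha.le hlt (pow_ne_zero _ (Fact.out : p.Prime).ne_zero)
      rw [pow_mul, norm_one_sub_pow_of_norm_natCast hpowlt (hunit u hu), hpow, Real.log_pow]
      push_cast
      ring)
    (fun M => by
      have hterm : ∀ n ∈ Finset.Icc 1 M, -Real.log ‖1 - lam ^ (p ^ (r + 1) * n)‖ =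
          -Real.log ‖1 - lam ^ p ^ (r + 1)‖ + Real.log p * padicValNat p n := by
        intro n hn
        have hn0 : n ≠ 0 := by
          have := (Finset.mem_Icc.1 hn).1
          omega
        rw [pow_mul, norm_one_sub_pow_of_small hp hunit hBsmall hn0,
          Real.log_mul hBpos.ne' (by positivity), Real.log_pow, Real.log_inv]
        ring
      rw [Finset.sum_congr rfl hterm, Finset.sum_add_distrib, Finset.sum_const, Nat.card_Icc,
        Nat.add_sub_cancel, nsmul_eq_mul, ← Finset.mul_sum, mul_comm (M : ℝ), div_mul_eq_mul_div,
        mul_div_assoc]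
      exact add_le_add_right
        (mul_le_mul_of_nonneg_left (sum_padicValNat_Icc_le M) hlogp.le) _)
    N
  rw [hlogB] at hsum
  have hR : 0 < Rr p (r + 1 + 1) := Rr_succ_pos _
  have hrT : 0 < rTilde p lam γ₀ 1 (r + 1) t := by
    unfold rTilde
    simp only [pow_one]
    positivity
  have hlogrT : Real.log (rTilde p lam γ₀ 1 (r + 1) t) =
      -(Real.log p / (p ^ (r + 1) * (p - 1)))
        - ((r + 1 : ℕ) - t) / p ^ (r + 1) * Real.log p
        + (r + 1 : ℕ) * (p - 1) / p * Real.log ‖1 - lam‖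
        + p ^ t / p ^ (r + 1) * Real.log ‖γ₀ - lam‖ := by
    unfold rTilde
    simp only [pow_one]
    rw [Real.log_mul (by positivity) (by positivity), Real.log_mul (by positivity) (by positivity),
      Real.log_mul (by positivity) (by positivity), Real.log_rpow hR, Real.log_rpow hp0,
      Real.log_rpow ha, Real.log_rpow hb, log_Rr_succ, Real.rpow_sub hp0, Real.rpow_natCast,
      Real.rpow_natCast, Nat.cast_one, one_mul, one_mul, one_mul, one_div_div]
    ring
  have hcount : (p : ℝ) ^ (r + 1) * (N / p ^ (r + 1) : ℕ) ≤ N - 1 := by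
    have hmod : N % p ^ (r + 1) ≠ 0 := fun h0 => hnd (Nat.dvd_of_mod_eq_zero h0)
    have hdm := Nat.div_add_mod N (p ^ (r + 1))
    have hle : p ^ (r + 1) * (N / p ^ (r + 1)) + 1 ≤ N := by omega
    have : ((p ^ (r + 1) * (N / p ^ (r + 1)) + 1 : ℕ) : ℝ) ≤ N := by exact_mod_cast hle
    push_cast at this
    linarith
  have hgain : Real.log p / (p - 1) * (N / p ^ (r + 1) : ℕ) ≤
      (N - 1) * (Real.log p / (p ^ (r + 1) * (p - 1))) := by
    have hp1' : (0 : ℝ) < p - 1 := by linarith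
    have hrw : (N - 1) * (Real.log p / (p ^ (r + 1) * (p - 1))) =
        Real.log p / (p - 1) * (((N : ℝ) - 1) / p ^ (r + 1)) := by
      field_simp
    rw [hrw]
    refine mul_le_mul_of_nonneg_left ?_ (by positivity)
    rw [le_div_iff₀ (by positivity), mul_comm]
    exact hcount
  have hprod : 0 < ∏ n ∈ Finset.Icc 1 N, ‖1 - lam ^ n‖ :=
    Finset.prod_pos fun n hn => (norm_nonneg _).lt_of_ne' (hne n (Finset.mem_Icc.1 hn).1)
  rw [← Real.log_le_log_iff (by positivity) (by positivity), Real.log_inv,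
    Real.log_prod fun n hn => hne n (Finset.mem_Icc.1 hn).1, ← Finset.sum_neg_distrib,
    Real.log_mul (by positivity) (by positivity), Real.log_mul (by positivity) (by positivity),
    Real.log_rpow ha, Real.log_rpow hrT, hlogrT, log_Rr_succ]
  refine hsum.trans ?_
  rw [← sub_nonneg] at hgain ⊢
  refine hgain.trans_eq ?_
  push_cast
  ring
end
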